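/- For every (a,b) ∈ Ω, the set {s > 0 : there exists v ∈ Λ with h_s g_{a,b} v ∈ (0,1]×{0}} has a least element, and this least element (the first return time of the horocycle flow to the section) equals R(a,b), where R(a,b) = 1/(a(a+b)) if (a,b) ∈ Ω₁, R(a,b) = 1/(a(aφ̄+b)) if (a,b) ∈ Ω_φ, and R(a,b) = 1/(ab) if (a,b) ∈ Ω_∞. -/

import Mathlib

open Matrix MeasureTheory Filter Topology

noncomputable section

abbrev SL2 := Matrix.SpecialLinearGroup (Fin 2) ℝ

/-- The golden ratio φ = (1+√5)/2. -/
def phi : ℝ := (1 + Real.sqrt 5) / 2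

/-- φ̄ = 1/φ. -/
def phib : ℝ := phi⁻¹

/-- S = [[0,−1],[1,0]]. -/
def Smat : SL2 := ⟨!![0, -1; 1, 0], by norm_num [Matrix.det_fin_two_of]⟩

/-- P = [[1,φ],[0,1]]. -/
def Pmat : SL2 := ⟨!![1, phi; 0, 1], by norm_num [Matrix.det_fin_two_of]⟩

/-- The Veech group of the golden L: the subgroup generated by S and P. -/
def Γ : Subgroup SL2 := Subgroup.closure {Smat, Pmat}

/-- Linear action of a 2×2 matrix on ℝ². -/
def mact (g : Matrix (Fin 2) (Fin 2) ℝ) (v : ℝ × ℝ) : ℝ × ℝ :=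
  (g 0 0 * v.1 + g 0 1 * v.2, g 1 0 * v.1 + g 1 1 * v.2)

/-- Λ = Γ·(1,0)ᵀ. -/
def Λ : Set (ℝ × ℝ) := {v | ∃ γ ∈ Γ, v = mact (γ : Matrix (Fin 2) (Fin 2) ℝ) (1, 0)}

/-- g_{a,b} = [[a,b],[0,1/a]]. -/
def gab (a b : ℝ) : Matrix (Fin 2) (Fin 2) ℝ := !![a, b; 0, a⁻¹]

/-- h_s = [[1,0],[−s,1]]. -/
def hmat (s : ℝ) : Matrix (Fin 2) (Fin 2) ℝ := !![1, 0; -s, 1]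

/-- Ω = {(a,b) : 0 < a ≤ 1, 1 − aφ < b ≤ 1}. -/
def Ω : Set (ℝ × ℝ) := {p | 0 < p.1 ∧ p.1 ≤ 1 ∧ 1 - p.1 * phi < p.2 ∧ p.2 ≤ 1}

/-- Ω₁ = {(a,b) ∈ Ω : φ̄ ≤ a ≤ 1, 1 − aφ < b ≤ φ̄ − a}. -/
def Ω₁ : Set (ℝ × ℝ) :=
  {p | p ∈ Ω ∧ phib ≤ p.1 ∧ p.1 ≤ 1 ∧ 1 - p.1 * phi < p.2 ∧ p.2 ≤ phib - p.1}

/-- Ω_φ = {(a,b) ∈ Ω : φ̄² ≤ a ≤ 1, φ̄ − a < b ≤ φ̄ − aφ̄}. -/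
def Ωphi : Set (ℝ × ℝ) :=
  {p | p ∈ Ω ∧ phib ^ 2 ≤ p.1 ∧ p.1 ≤ 1 ∧ phib - p.1 < p.2 ∧ p.2 ≤ phib - p.1 * phib}

/-- Ω_∞ = {(a,b) ∈ Ω : φ̄ − aφ̄ < b ≤ 1}. -/
def Ωinf : Set (ℝ × ℝ) := {p | p ∈ Ω ∧ phib - p.1 * phib < p.2 ∧ p.2 ≤ 1}

-- The return time function R.
open Classical in
noncomputable def Rfun (p : ℝ × ℝ) : ℝ :=
  if p ∈ Ω₁ then 1 / (p.1 * (p.1 + p.2))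
  else if p ∈ Ωphi then 1 / (p.1 * (p.1 * phib + p.2))
  else 1 / (p.1 * p.2)

/-- The probability measure m with dm = (2/φ) da db on Ω. -/
noncomputable def m : Measure (ℝ × ℝ) := ENNReal.ofReal (2 / phi) • volume.restrict Ω

-- The golden-L BCZ map T.
open Classical in
noncomputable def Tmap (p : ℝ × ℝ) : ℝ × ℝ :=
  if p ∈ Ω₁ then
    ((p.1 + p.2) * phi,
      p.1 + p.2 * phi +
        (-(⌊(p.1 + p.2 * phi - 1) / (phi ^ 2 * (p.1 + p.2))⌋ : ℤ) : ℝ) * phi ^ 2 * (p.1 + p.2))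
  else if p ∈ Ωphi then
    (p.1 + p.2 * phi,
      p.2 + (-(⌊(p.2 - 1) / (phi * (p.1 + p.2 * phi))⌋ : ℤ) : ℝ) * phi * (p.1 + p.2 * phi))
  else
    (p.2, -p.1 + (-(⌊(-p.1 - 1) / (phi * p.2)⌋ : ℤ) : ℝ) * phi * p.2)

theorem phi_sq : phi * phi = phi + 1 := by
  have h : Real.sqrt 5 * Real.sqrt 5 = 5 := Real.mul_self_sqrt (by norm_num)
  unfold phi
  linarith

theorem one_lt_phi : 1 < phi := by
  have h : (1 : ℝ) < Real.sqrt 5 := by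
    rw [Real.lt_sqrt] <;> norm_num
  unfold phi
  linarith

theorem phib_eq : phib = phi - 1 := by
  have h1 := phi_sq
  have h2 := one_lt_phi
  unfold phib
  refine inv_eq_of_mul_eq_one_right ?_
  linarith

/-- The vectors `(x, y)` obtained from `(1, 0)` and `(0, 1)` by the four matrices mapping the first
quadrant onto the sectors cut out by `(1, 0)`, `(φ, 1)`, `(φ, φ)`, `(1, φ)`, `(0, 1)`. -/
inductive QuadrantOrbit : ℝ → ℝ → Prop
  | right : QuadrantOrbit 1 0
  | up : QuadrantOrbit 0 1
  | sector₀ {p q x y : ℝ} : QuadrantOrbit p q → x = p + phi * q → y = q → QuadrantOrbit x y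
  | sector₁ {p q x y : ℝ} : QuadrantOrbit p q → x = phi * p + phi * q → y = p + phi * q →
      QuadrantOrbit x y
  | sector₂ {p q x y : ℝ} : QuadrantOrbit p q → x = phi * p + q → y = phi * p + phi * q →
      QuadrantOrbit x y
  | sector₃ {p q x y : ℝ} : QuadrantOrbit p q → x = p → y = phi * p + q → QuadrantOrbit x y

theorem QuadrantOrbit.eq_zero_or_one_le {x y : ℝ} (h : QuadrantOrbit x y) :
    (x = 0 ∨ 1 ≤ x) ∧ (y = 0 ∨ 1 ≤ y) := by
  have add {s t : ℝ} (hs : s = 0 ∨ 1 ≤ s) (ht : t = 0 ∨ 1 ≤ t) : s + t = 0 ∨ 1 ≤ s + t := by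
    rcases hs with rfl | hs <;> rcases ht with rfl | ht
    · left; ring
    all_goals right; linarith
  have mul {s : ℝ} (hs : s = 0 ∨ 1 ≤ s) : phi * s = 0 ∨ 1 ≤ phi * s := by
    rcases hs with rfl | hs
    · left; ring
    · right; nlinarith [one_lt_phi]
  induction h with
  | right => norm_num
  | up => norm_num
  | sector₀ _ hx hy ih => subst hx hy; exact ⟨add ih.1 (mul ih.2), ih.2⟩
  | sector₁ _ hx hy ih => subst hx hy; exact ⟨add (mul ih.1) (mul ih.2), add ih.1 (mul ih.2)⟩
  | sector₂ _ hx hy ih => subst hx hy; exact ⟨add (mul ih.1) ih.2, add (mul ih.1) (mul ih.2)⟩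
  | sector₃ _ hx hy ih => subst hx hy; exact ⟨ih.1, add (mul ih.1) ih.2⟩

/-- The vectors one of whose rotations by a multiple of a right angle is in `QuadrantOrbit`. -/
def RotatedOrbit (x y : ℝ) : Prop :=
  QuadrantOrbit x y ∨ QuadrantOrbit y (-x) ∨ QuadrantOrbit (-x) (-y) ∨ QuadrantOrbit (-y) x

theorem RotatedOrbit.rotate {x y : ℝ} (h : RotatedOrbit x y) : RotatedOrbit (-y) x := by
  unfold RotatedOrbit at *
  rw [neg_neg]
  tauto

theorem QuadrantOrbit.shear_rotate {p q : ℝ} (h : QuadrantOrbit p q) :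
    RotatedOrbit (-q + phi * p) p := by
  have hphi := phi_sq
  cases h with
  | right => exact .inl (.sector₀ .up (by ring) rfl)
  | up => exact .inr (.inr (.inl (by convert QuadrantOrbit.right using 1 <;> ring)))
  | sector₀ h hx hy => exact .inl (.sector₁ h (by subst hx hy; grind) hx)
  | sector₁ h hx hy => exact .inl (.sector₂ h (by subst hx hy; grind) hx)
  | sector₂ h hx hy => exact .inl (.sector₃ h (by subst hx hy; grind) hx)
  | @sector₃ u w _ _ h hx hy =>
    subst hx hy
    have := RotatedOrbit.rotate (.inl h)
    convert this using 1
    ring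

theorem RotatedOrbit.shear {x y : ℝ} (h : RotatedOrbit x y) : RotatedOrbit (x + phi * y) y := by
  rcases h with h | h | h | h
  · exact .inl (.sector₀ h rfl rfl)
  · simpa using h.shear_rotate
  · refine .inr (.inr (.inl (.sector₀ h ?_ rfl)))
    ring
  · convert h.shear_rotate.rotate.rotate using 1 <;> ring

theorem RotatedOrbit.shear_neg {x y : ℝ} (h : RotatedOrbit x y) :
    RotatedOrbit (x - phi * y) y := by
  have hphi := phi_sq
  convert h.rotate.shear.rotate.shear.rotate.shear.rotate.shear.rotate.rotate.rotate
    using 1 <;> grind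

theorem mact_mul (g h : Matrix (Fin 2) (Fin 2) ℝ) (v : ℝ × ℝ) :
    mact (g * h) v = mact g (mact h v) := by
  simp only [mact, Matrix.mul_apply, Fin.sum_univ_two, Prod.mk.injEq]
  constructor <;> ring

theorem rotatedOrbit_mact {γ : SL2} (hγ : γ ∈ Γ) :
    (∀ v : ℝ × ℝ, RotatedOrbit v.1 v.2 →
      RotatedOrbit (mact (γ : Matrix (Fin 2) (Fin 2) ℝ) v).1
        (mact (γ : Matrix (Fin 2) (Fin 2) ℝ) v).2) ∧
    (∀ v : ℝ × ℝ, RotatedOrbit v.1 v.2 →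
      RotatedOrbit (mact ((γ⁻¹ : SL2) : Matrix (Fin 2) (Fin 2) ℝ) v).1
        (mact ((γ⁻¹ : SL2) : Matrix (Fin 2) (Fin 2) ℝ) v).2) := by
  induction hγ using Subgroup.closure_induction with
  | mem g hg =>
    rcases hg with rfl | rfl
    · refine ⟨fun v hv => ?_, fun v hv => ?_⟩
      · simpa [mact, Smat] using hv.rotate
      · rw [Matrix.SpecialLinearGroup.coe_inv]
        simpa [mact, Smat, Matrix.adjugate_fin_two_of] using hv.rotate.rotate.rotate
    · refine ⟨fun v hv => ?_, fun v hv => ?_⟩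
      · simpa [mact, Pmat] using hv.shear
      · rw [Matrix.SpecialLinearGroup.coe_inv]
        simpa [mact, Pmat, Matrix.adjugate_fin_two_of, sub_eq_add_neg] using hv.shear_neg
  | one => simp [mact]
  | mul g h _ _ hg hh =>
    refine ⟨fun v hv => ?_, fun v hv => ?_⟩
    · rw [Matrix.SpecialLinearGroup.coe_mul, mact_mul]
      exact hg.1 _ (hh.1 _ hv)
    · rw [_root_.mul_inv_rev, Matrix.SpecialLinearGroup.coe_mul, mact_mul]
      exact hh.2 _ (hg.2 _ hv)
  | inv g _ hg => exact ⟨hg.2, by simpa using hg.1⟩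

theorem quadrantOrbit_of_mem_Λ {v : ℝ × ℝ} (hv : v ∈ Λ) (hx : 0 < v.1) (hy : 0 < v.2) :
    QuadrantOrbit v.1 v.2 := by
  obtain ⟨γ, hγ, rfl⟩ := hv
  rcases (rotatedOrbit_mact hγ).1 (1, 0) (.inl .right) with h | h | h | h
  · exact h
  all_goals
    rcases h.eq_zero_or_one_le with ⟨h1 | h1, h2 | h2⟩ <;> linarith

theorem up_mem_Λ : ((0, 1) : ℝ × ℝ) ∈ Λ :=
  ⟨Smat, Subgroup.subset_closure (by simp), by simp [mact, Smat]⟩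

theorem shear_rotate_mem_Λ {x y : ℝ} (h : (x, y) ∈ Λ) : (-y + phi * x, x) ∈ Λ := by
  obtain ⟨γ, hγ, h⟩ := h
  refine ⟨Pmat * Smat * γ, Γ.mul_mem (Γ.mul_mem (Subgroup.subset_closure (by simp))
    (Subgroup.subset_closure (by simp))) hγ, ?_⟩
  rw [Matrix.SpecialLinearGroup.coe_mul, mact_mul, ← h, Matrix.SpecialLinearGroup.coe_mul, mact_mul]
  simp [mact, Smat, Pmat]

theorem right_mem_Λ : ((1, 0) : ℝ × ℝ) ∈ Λ := ⟨1, Γ.one_mem, by simp [mact]⟩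

theorem diag_mem_Λ : (phi, phi) ∈ Λ := by
  have h := shear_rotate_mem_Λ (shear_rotate_mem_Λ right_mem_Λ)
  convert h using 2
  · linarith [phi_sq]
  · ring

theorem one_phi_mem_Λ : (1, phi) ∈ Λ := by
  have h := shear_rotate_mem_Λ diag_mem_Λ
  convert h using 2
  linarith [phi_sq]

theorem mact_hmat_gab (a b s x y : ℝ) :
    mact (hmat s * gab a b) (x, y) = (a * x + b * y, y * a⁻¹ - s * (a * x + b * y)) := by
  simp only [mact_mul]
  simp [mact, hmat, gab]
  ring

/-- The return time is governed by the vector of `Λ` with positive height, and width in `(0, 1]`,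
that has the smallest slope. -/
theorem isLeast_return_time {a b x₀ y₀ : ℝ} (ha : 0 < a) (hmem : (x₀, y₀) ∈ Λ) (hy₀ : 0 < y₀)
    (hpos : 0 < a * x₀ + b * y₀) (hle : a * x₀ + b * y₀ ≤ 1)
    (hmin : ∀ x y : ℝ, (x, y) ∈ Λ → 0 < y → a * x + b * y ≤ 1 → x * y₀ ≤ x₀ * y) :
    IsLeast
      {s : ℝ | 0 < s ∧ ∃ v ∈ Λ,
        0 < (mact (hmat s * gab a b) v).1 ∧ (mact (hmat s * gab a b) v).1 ≤ 1 ∧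
        (mact (hmat s * gab a b) v).2 = 0}
      (y₀ / (a * (a * x₀ + b * y₀))) := by
  constructor
  · refine ⟨by positivity, (x₀, y₀), hmem, ?_⟩
    rw [mact_hmat_gab]
    refine ⟨hpos, hle, ?_⟩
    have : y₀ / (a * (a * x₀ + b * y₀)) * (a * x₀ + b * y₀) = y₀ * a⁻¹ := by
      rw [← div_div, div_mul_cancel₀ _ hpos.ne', div_eq_mul_inv]
    simp only [this, sub_self]
  · rintro s ⟨hs, ⟨x, y⟩, hv, h⟩
    rw [mact_hmat_gab] at h
    obtain ⟨h1, h2, h3⟩ := h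
    simp only at h1 h2 h3
    have h4 : y = s * (a * (a * x + b * y)) := by
      field_simp at h3
      linarith
    have hy : 0 < y := by rw [h4]; positivity
    have h5 := hmin x y hv hy h2
    have h6 : s = y / (a * (a * x + b * y)) := by rw [eq_div_iff (by positivity), ← h4]
    rw [h6, div_le_div_iff₀ (by positivity) (by positivity)]
    nlinarith [mul_le_mul_of_nonneg_left h5 (by positivity : 0 ≤ a * a)]

theorem one_lt_mul_add_mul {p q s t : ℝ} (hp : 1 ≤ p) (hq : 0 ≤ q) (hs : 1 < s) (ht : 0 ≤ t) :
    1 < p * s + q * t := by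
  nlinarith [mul_nonneg hq ht]

/-- For (a,b) ∈ Ω, the set of times s > 0 at which the horocycle orbit h_s g_{a,b}Λ meets
the segment (0,1]×{0} has a least element, equal to R(a,b). -/
theorem return_time_isLeast :
    ∀ a b : ℝ, (a, b) ∈ Ω →
      IsLeast
        {s : ℝ | 0 < s ∧ ∃ v ∈ Λ,
          0 < (mact (hmat s * gab a b) v).1 ∧ (mact (hmat s * gab a b) v).1 ≤ 1 ∧
          (mact (hmat s * gab a b) v).2 = 0}
        (Rfun (a, b)) := by
  intro a b hab
  obtain ⟨ha, ha1, hb, hb1⟩ := hab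
  simp only at ha ha1 hb hb1
  have hphi := phi_sq
  have hphi1 := one_lt_phi
  have hbar := phib_eq
  have hprod : phi * phib = 1 := by rw [hbar]; linarith
  have haphi : 0 ≤ (1 - a) * (phi - 1) := mul_nonneg (by linarith) (by linarith)
  have hsum : 0 < a + b := by nlinarith
  have hright : 1 < a * phi + b := by linarith
  unfold Rfun
  split_ifs with h1 h2
  · obtain ⟨-, -, -, -, h⟩ := h1
    simp only at h
    convert isLeast_return_time (b := b) ha diag_mem_Λ (by linarith) (by nlinarith)
      (by nlinarith) ?_ using 1
    · rw [← add_mul]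
      field_simp
    · intro x y hv hy hle
      by_contra! hlt
      have hxy : y < x := by nlinarith
      have hquad := quadrantOrbit_of_mem_Λ hv (hy.trans hxy) hy
      simp only at hquad
      cases hquad with
      | right => linarith
      | up => linarith
      | @sector₀ p q _ _ h hx hy' =>
        obtain ⟨hp, hq⟩ := h.eq_zero_or_one_le
        have := one_lt_mul_add_mul (p := q) (q := p) (by grind) (by grind) hright ha.le
        rw [hx, hy'] at hle
        linarith
      | @sector₁ p q _ _ h hx hy' =>
        obtain ⟨hp, hq⟩ := h.eq_zero_or_one_le
        have := one_lt_mul_add_mul (p := p) (q := q) (t := phi * (a + b))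
          (by grind) (by grind) hright (by positivity)
        rw [hx, hy'] at hle
        linarith
      | @sector₂ p q _ _ h hx hy' =>
        obtain ⟨hp, hq⟩ := h.eq_zero_or_one_le
        have : 0 ≤ q := by grind
        nlinarith
      | @sector₃ p q _ _ h hx hy' =>
        obtain ⟨hp, hq⟩ := h.eq_zero_or_one_le
        have : 0 ≤ p := by grind
        have : 0 ≤ q := by grind
        nlinarith
  · obtain ⟨-, -, -, h', h⟩ := h2
    simp only at h h'
    have hdiag : 1 < phi * (a + b) := by nlinarith
    have htop : 0 < a + b * phi := by nlinarith
    convert isLeast_return_time (b := b) ha one_phi_mem_Λ (by linarith) (by linarith)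
      (by nlinarith) ?_ using 1
    · have : a * 1 + b * phi = phi * (a * phib + b) := by linear_combination -a * hprod
      rw [this]
      field_simp
    · intro x y hv hy hle
      by_contra! hlt
      have hxpos : 0 < x := by nlinarith
      have hquad := quadrantOrbit_of_mem_Λ hv hxpos hy
      simp only at hquad
      cases hquad with
      | right => linarith
      | up => linarith
      | @sector₀ p q _ _ h hx hy' =>
        obtain ⟨hp, hq⟩ := h.eq_zero_or_one_le
        have := one_lt_mul_add_mul (p := q) (q := p) (by grind) (by grind) hright ha.le
        rw [hx, hy'] at hle
        linarith
      | @sector₁ p q _ _ h hx hy' =>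
        obtain ⟨hp, hq⟩ := h.eq_zero_or_one_le
        have : 1 < p * (a * phi + b) + q * (phi * (a + b)) := by
          rcases hp with rfl | hp
          · nlinarith [one_lt_mul_add_mul (p := q) (q := 0) (by grind) le_rfl hdiag le_rfl]
          · exact one_lt_mul_add_mul hp (by grind) hright (by linarith)
        rw [hx, hy'] at hle
        linarith
      | @sector₂ p q _ _ h hx hy' =>
        obtain ⟨hp, hq⟩ := h.eq_zero_or_one_le
        have := one_lt_mul_add_mul (p := p) (q := q) (by grind) (by grind) hdiag htop.le
        rw [hx, hy'] at hle
        linarith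
      | @sector₃ p q _ _ h hx hy' =>
        obtain ⟨hp, hq⟩ := h.eq_zero_or_one_le
        have : 0 ≤ q := by grind
        nlinarith
  · have h : phib - a * phib < b := by
      by_contra! hle
      have hpb : phib ^ 2 = 2 - phi := by rw [hbar]; linarith [sq (phi - 1)]
      by_cases hab : b ≤ phib - a
      · refine h1 ⟨⟨ha, ha1, hb, hb1⟩, ?_, ha1, hb, hab⟩
        simp only
        nlinarith
      · refine h2 ⟨⟨ha, ha1, hb, hb1⟩, ?_, ha1, not_le.mp hab, hle⟩
        simp only
        nlinarith
    have hdiag : 1 < phi * (a + b) := by nlinarith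
    have htop : 1 < a + b * phi := by nlinarith
    have hb0 : 0 < b := by nlinarith
    convert isLeast_return_time (b := b) ha up_mem_Λ one_pos (by linarith) (by linarith) ?_ using 1
    · simp
    · intro x y hv hy hle
      by_contra! hlt
      have hquad := quadrantOrbit_of_mem_Λ hv (by linarith) hy
      simp only at hquad
      cases hquad with
      | right => linarith
      | up => linarith
      | @sector₀ p q _ _ h hx hy' =>
        obtain ⟨hp, hq⟩ := h.eq_zero_or_one_le
        have := one_lt_mul_add_mul (p := q) (q := p) (by grind) (by grind) hright ha.le
        rw [hx, hy'] at hle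
        linarith
      | @sector₁ p q _ _ h hx hy' =>
        obtain ⟨hp, hq⟩ := h.eq_zero_or_one_le
        have : 1 < p * (a * phi + b) + q * (phi * (a + b)) := by
          rcases hp with rfl | hp
          · nlinarith [one_lt_mul_add_mul (p := q) (q := 0) (by grind) le_rfl hdiag le_rfl]
          · exact one_lt_mul_add_mul hp (by grind) hright (by linarith)
        rw [hx, hy'] at hle
        linarith
      | @sector₂ p q _ _ h hx hy' =>
        obtain ⟨hp, hq⟩ := h.eq_zero_or_one_le
        have : 1 < p * (phi * (a + b)) + q * (a + b * phi) := by
          rcases hp with rfl | hp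
          · nlinarith [one_lt_mul_add_mul (p := q) (q := 0) (by grind) le_rfl htop le_rfl]
          · exact one_lt_mul_add_mul hp (by grind) hdiag (by linarith)
        rw [hx, hy'] at hle
        linarith
      | @sector₃ p q _ _ h hx hy' =>
        obtain ⟨hp, hq⟩ := h.eq_zero_or_one_le
        have := one_lt_mul_add_mul (p := p) (q := q) (by grind) (by grind) htop hb0.le
        rw [hx, hy'] at hle
        linarith
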